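/- For 1 ≤ k ≤ e−1, the monoid B^{⊕k}(e,e,n) is isomorphic to the Corran–Picantin monoid B^{⊕}(e,e,n) = B^{⊕1}(e,e,n) if and only if gcd(k, e) = 1. Moreover, when gcd(k,e) = 1, an isomorphism is given by sending s̃_j ↦ s̃_j and t̃_i ↦ t̃_{ik}. -/

import Mathlib

noncomputable section

/-- Index type for the generators `t̃_0,…,t̃_{e-1}` (left) and
`s̃_3,…,s̃_n` (right, `p : Fin (n-2)` corresponds to `s̃_{p+3}`). -/
abbrev BkGen (e n : ℕ) := ZMod e ⊕ Fin (n - 2)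

open FreeMonoid in
/-- The defining relations of the monoid `B^{⊕k}(e,e,n)`. -/
inductive BkRel (e n k : ℕ) :
    FreeMonoid (BkGen e n) → FreeMonoid (BkGen e n) → Prop
  | braidS (p q : Fin (n - 2)) (h : (p : ℕ) + 1 = (q : ℕ) ∨ (q : ℕ) + 1 = (p : ℕ)) :
      BkRel e n k (of (Sum.inr p) * of (Sum.inr q) * of (Sum.inr p))
        (of (Sum.inr q) * of (Sum.inr p) * of (Sum.inr q))
  | commS (p q : Fin (n - 2)) (h : (p : ℕ) + 1 < (q : ℕ) ∨ (q : ℕ) + 1 < (p : ℕ)) :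
      BkRel e n k (of (Sum.inr p) * of (Sum.inr q)) (of (Sum.inr q) * of (Sum.inr p))
  | braidTS (i : ZMod e) (p : Fin (n - 2)) (hp : (p : ℕ) = 0) :
      BkRel e n k (of (Sum.inr p) * of (Sum.inl i) * of (Sum.inr p))
        (of (Sum.inl i) * of (Sum.inr p) * of (Sum.inl i))
  | commTS (i : ZMod e) (p : Fin (n - 2)) (hp : 1 ≤ (p : ℕ)) :
      BkRel e n k (of (Sum.inr p) * of (Sum.inl i)) (of (Sum.inl i) * of (Sum.inr p))
  | relT (i j : ZMod e) :
      BkRel e n k (of (Sum.inl i) * of (Sum.inl (i - (k : ZMod e))))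
        (of (Sum.inl j) * of (Sum.inl (j - (k : ZMod e))))

/-- The monoid `B^{⊕k}(e,e,n)` presented by the relations `BkRel e n k`. -/
abbrev BkMonoid (e n k : ℕ) := (conGen (BkRel e n k)).Quotient

/-- The homomorphism `s̃_j ↦ s̃_j`, `t̃_i ↦ t̃_{iu}` from `B^{⊕k}(e,e,n)` to `B^{⊕m}(e,e,n)`,
where `k u = m` modulo `e`. -/
def BkMonoid.twist {e n k m : ℕ} (u : ZMod e) (h : (k : ZMod e) * u = m) :
    BkMonoid e n k →* BkMonoid e n m :=
  (conGen (BkRel e n k)).lift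
    ((conGen (BkRel e n m)).mk'.comp (FreeMonoid.map (Sum.map (· * u) id))) <| by
    refine Con.conGen_le.2 fun x y hxy => ?_
    rw [Con.ker_rel, MonoidHom.comp_apply, MonoidHom.comp_apply]
    refine (Con.eq _).2 (ConGen.Rel.of _ _ ?_)
    cases hxy with
    | braidS p q h => simpa using BkRel.braidS p q h
    | commS p q h => simpa using BkRel.commS p q h
    | braidTS i p h => simpa using BkRel.braidTS (i * u) p h
    | commTS i p h => simpa using BkRel.commTS (i * u) p h
    | relT i j => simpa [sub_mul, h] using BkRel.relT (n := n) (k := m) (i * u) (j * u)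

theorem BkMonoid.twist_mk_of {e n k m : ℕ} (u : ZMod e) (h : (k : ZMod e) * u = m)
    (g : BkGen e n) :
    BkMonoid.twist (n := n) u h ((conGen (BkRel e n k)).mk' (FreeMonoid.of g)) =
      (conGen (BkRel e n m)).mk' (FreeMonoid.of (Sum.map (· * u) id g)) :=
  rfl

theorem BkMonoid.hom_ext {e n k : ℕ} {M : Type*} [Monoid M] {f g : BkMonoid e n k →* M}
    (h : ∀ a, f ((conGen (BkRel e n k)).mk' (FreeMonoid.of a)) =
      g ((conGen (BkRel e n k)).mk' (FreeMonoid.of a))) : f = g :=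
  Con.hom_ext (FreeMonoid.hom_eq h)

/-- Twisting by a unit is an isomorphism. -/
def BkMonoid.twistEquiv {e n k m : ℕ} (u v : ZMod e) (huv : u * v = 1)
    (h : (k : ZMod e) * u = m) : BkMonoid e n k ≃* BkMonoid e n m :=
  MonoidHom.toMulEquiv (BkMonoid.twist u h)
    (BkMonoid.twist v (by rw [← h, mul_assoc, huv, mul_one]))
    (BkMonoid.hom_ext fun a => by
      rw [MonoidHom.comp_apply, twist_mk_of, twist_mk_of]
      cases a <;> simp [mul_assoc, huv])
    (BkMonoid.hom_ext fun a => by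
      rw [MonoidHom.comp_apply, twist_mk_of, twist_mk_of]
      cases a <;> simp [mul_assoc, mul_comm v u, huv])

/-- Word length, as a homomorphism on `B^{⊕k}(e,e,n)`. -/
def BkMonoid.len (e n k : ℕ) : BkMonoid e n k →* Multiplicative ℕ :=
  (conGen (BkRel e n k)).lift
    (FreeMonoid.lift fun _ => Multiplicative.ofAdd 1) <| by
    refine Con.conGen_le.2 fun x y hxy => ?_
    rw [Con.ker_rel]
    cases hxy <;> simp

theorem BkMonoid.len_mk_of {e n k : ℕ} (g : BkGen e n) :
    BkMonoid.len e n k ((conGen (BkRel e n k)).mk' (FreeMonoid.of g)) =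
      Multiplicative.ofAdd 1 := by
  rw [BkMonoid.len, Con.lift_mk', FreeMonoid.lift_eval_of]

theorem BkMonoid.eq_one_or_eq_of_mul {e n k : ℕ} (x : BkMonoid e n k) :
    x = 1 ∨ ∃ g y, x = (conGen (BkRel e n k)).mk' (FreeMonoid.of g) * y := by
  induction x using Con.induction_on with
  | H w =>
    induction w using FreeMonoid.casesOn with
    | one => exact .inl rfl
    | of_mul g w => exact .inr ⟨g, (conGen (BkRel e n k)).mk' w, rfl⟩

theorem BkMonoid.len_eq_one_iff {e n k : ℕ} {x : BkMonoid e n k} :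
    BkMonoid.len e n k x = 1 ↔ x = 1 := by
  refine ⟨fun h => ?_, fun h => by rw [h, map_one]⟩
  obtain rfl | ⟨g, y, rfl⟩ := x.eq_one_or_eq_of_mul
  · rfl
  · rw [map_mul, len_mk_of] at h
    have := congrArg Multiplicative.toAdd h
    simp at this

theorem BkMonoid.mk_of_ne_one {e n k : ℕ} (g : BkGen e n) :
    (conGen (BkRel e n k)).mk' (FreeMonoid.of g) ≠ 1 := by
  rw [Ne, ← len_eq_one_iff, len_mk_of]
  decide

/-- Isomorphisms send generators to generators. -/
theorem BkMonoid.exists_map_mk_of {e n k m : ℕ} (φ : BkMonoid e n k ≃* BkMonoid e n m)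
    (g : BkGen e n) :
    ∃ g', φ ((conGen (BkRel e n k)).mk' (FreeMonoid.of g)) =
      (conGen (BkRel e n m)).mk' (FreeMonoid.of g') := by
  obtain h | ⟨g', y, h⟩ := (φ ((conGen (BkRel e n k)).mk' (FreeMonoid.of g))).eq_one_or_eq_of_mul
  · exact absurd ((map_eq_one_iff φ φ.injective).1 h) (mk_of_ne_one g)
  · refine ⟨g', ?_⟩
    have hlen := len_mk_of (k := k) g
    rw [← φ.symm_apply_apply ((conGen (BkRel e n k)).mk' (FreeMonoid.of g)), h, map_mul,
      map_mul] at hlen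
    have hg' : len e n k (φ.symm ((conGen (BkRel e n m)).mk' (FreeMonoid.of g'))) ≠ 1 := by
      rw [Ne, len_eq_one_iff, map_eq_one_iff φ.symm φ.symm.injective]
      exact mk_of_ne_one g'
    have hy : len e n k (φ.symm y) = 1 := by
      have h₁ := congrArg Multiplicative.toAdd hlen
      rw [toAdd_mul, toAdd_ofAdd] at h₁
      have h₂ : Multiplicative.toAdd
          (len e n k (φ.symm ((conGen (BkRel e n m)).mk' (FreeMonoid.of g')))) ≠ 0 := hg'
      apply Multiplicative.toAdd.injective
      rw [toAdd_one]
      omega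
    rw [len_eq_one_iff, map_eq_one_iff φ.symm φ.symm.injective] at hy
    rw [h, hy, mul_one]

/-- The words `t̃_i t̃_{i-k}`. -/
def IsDelta (e n k : ℕ) (w : List (BkGen e n)) : Prop :=
  ∃ i : ZMod e, w = [Sum.inl i, Sum.inl (i - (k : ZMod e))]

/-- A congruence containing the defining relations which is the identity on words of length less
than two and identifies words of length two only if both have the form `t̃_i t̃_{i-k}` or they are
permutations of each other. -/
def shortCon (e n k : ℕ) : Con (FreeMonoid (BkGen e n)) where
  r u v := u.toList.length = v.toList.length ∧ (u.toList.length < 2 → u = v) ∧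
    (u.toList.length = 2 → (IsDelta e n k u.toList ↔ IsDelta e n k v.toList) ∧
      (IsDelta e n k u.toList ∨ u.toList.Perm v.toList))
  iseqv :=
    { refl := fun u => ⟨rfl, fun _ => rfl, fun _ => ⟨Iff.rfl, .inr (List.Perm.refl _)⟩⟩
      symm := fun {u v} ⟨h₁, h₂, h₃⟩ => ⟨h₁.symm, fun h => (h₂ (h₁ ▸ h)).symm, fun h =>
        have ⟨h₄, h₅⟩ := h₃ (h₁ ▸ h)
        ⟨h₄.symm, h₅.imp h₄.1 List.Perm.symm⟩⟩
      trans := fun {u v w} ⟨h₁, h₂, h₃⟩ ⟨h₁', h₂', h₃'⟩ => by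
        refine ⟨h₁.trans h₁', fun h => (h₂ h).trans (h₂' (h₁ ▸ h)), fun h => ?_⟩
        obtain ⟨h₄, h₅⟩ := h₃ h
        obtain ⟨h₄', h₅'⟩ := h₃' (h₁ ▸ h)
        refine ⟨h₄.trans h₄', ?_⟩
        rcases h₅ with h₅ | h₅
        · exact .inl h₅
        · exact h₅'.imp h₄.2 h₅.trans }
  mul' := by
    rintro u v u' v' ⟨h₁, h₂, h₃⟩ ⟨h₁', h₂', h₃'⟩
    by_cases hu : u.toList.length < 2
    · obtain rfl := h₂ hu
      by_cases hu' : u'.toList.length < 2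
      · obtain rfl := h₂' hu'
        exact ⟨rfl, fun _ => rfl, fun _ => ⟨Iff.rfl, .inr (List.Perm.refl _)⟩⟩
      · by_cases hu₀ : u.toList.length = 0
        · obtain rfl : u = 1 := List.length_eq_zero_iff.1 hu₀
          simpa only [one_mul] using And.intro h₁' ⟨h₂', h₃'⟩
        · simp only [FreeMonoid.toList_mul, List.length_append]
          exact ⟨by omega, fun _ => by omega, fun _ => by omega⟩
    · by_cases hu₀ : u'.toList.length = 0
      · obtain rfl := h₂' (by omega)
        obtain rfl : u' = 1 := List.length_eq_zero_iff.1 hu₀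
        simpa only [mul_one] using And.intro h₁ ⟨h₂, h₃⟩
      · simp only [FreeMonoid.toList_mul, List.length_append]
        exact ⟨by omega, fun _ => by omega, fun _ => by omega⟩

theorem conGen_le_shortCon (e n k : ℕ) : conGen (BkRel e n k) ≤ shortCon e n k := by
  refine Con.conGen_le.2 fun x y hxy => ?_
  change _ ∧ _ ∧ _
  cases hxy with
  | braidS p q h => simp
  | commS p q h => simpa [IsDelta] using List.Perm.swap _ _ _
  | braidTS i p h => simp
  | commTS i p h => simpa [IsDelta] using List.Perm.swap _ _ _
  | relT i j => simp [IsDelta]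

theorem BkMonoid.mk_mul_mk_sub {e n k : ℕ} (i j : ZMod e) :
    (conGen (BkRel e n k)).mk' (FreeMonoid.of (Sum.inl i)) *
        (conGen (BkRel e n k)).mk' (FreeMonoid.of (Sum.inl (i - k))) =
      (conGen (BkRel e n k)).mk' (FreeMonoid.of (Sum.inl j)) *
        (conGen (BkRel e n k)).mk' (FreeMonoid.of (Sum.inl (j - k))) := by
  rw [← map_mul, ← map_mul]
  exact (Con.eq _).2 (ConGen.Rel.of _ _ (BkRel.relT i j))

theorem mk_of_injective (e n k : ℕ) :
    Function.Injective fun g => (conGen (BkRel e n k)).mk' (FreeMonoid.of g) := by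
  intro a b h
  exact FreeMonoid.of_injective
    ((conGen_le_shortCon e n k ((Con.eq _).1 h)).2.1 (by simp))

/-- If `e ≥ 3`, an injective family of generators of `B^{⊕k}(e,e,n)` in which all products
`a_i a_{i-1}` agree exists only when `k` is invertible modulo `e`. -/
theorem isUnit_of_injective_of_mul_eq {e n k : ℕ} (he : 3 ≤ e) (a : ZMod e → BkGen e n)
    (ha : Function.Injective a)
    (h : ∀ i j, conGen (BkRel e n k) (FreeMonoid.of (a i) * FreeMonoid.of (a (i - 1)))
      (FreeMonoid.of (a j) * FreeMonoid.of (a (j - 1)))) :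
    IsUnit (k : ZMod e) := by
  have : NeZero e := ⟨by omega⟩
  have hdelta (i : ZMod e) : IsDelta e n k [a i, a (i - 1)] := by
    refine ((conGen_le_shortCon e n k (h i (i + 1))).2.2 rfl).2.resolve_right fun hp => ?_
    replace hp : List.Perm [a i, a (i - 1)] [a (i + 1), a i] := by simpa using hp
    have h₁ := (hp.trans (List.Perm.swap _ _ _)).cons_inv
    have h₂ : i - 1 = i + 1 := ha (by simpa using h₁)
    have h₃ : ((2 : ℕ) : ZMod e) = 0 := by push_cast; linear_combination -h₂
    have := Nat.le_of_dvd two_pos ((ZMod.natCast_eq_zero_iff 2 e).1 h₃)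
    omega
  choose σ hσ using hdelta
  have hσa (i : ZMod e) : a i = Sum.inl (σ i) := by simpa using (List.cons.inj (hσ i)).1
  have hσinj : Function.Injective σ := fun i j hij => ha (by rw [hσa, hσa, hij])
  have hstep (i : ZMod e) : σ (i - 1) = σ i - k := by
    have := hσ i
    rw [hσa, hσa] at this
    simpa using this
  have hpow (m : ℕ) : σ (-m) = σ 0 - m * k := by
    induction m with
    | zero => simp
    | succ m ih =>
      rw [Nat.cast_succ, neg_add', hstep, ih]
      ring
  obtain ⟨j, hj⟩ := (Finite.injective_iff_surjective.1 hσinj) (σ 0 - 1)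
  obtain ⟨m, hm⟩ := ZMod.natCast_zmod_surjective (-j)
  have hm' := hpow m
  rw [hm, neg_neg, hj] at hm'
  exact IsUnit.of_mul_eq_one (-j) (by linear_combination hm')

theorem coprime_of_mulEquiv {e n k : ℕ} (he : 3 ≤ e) (φ : BkMonoid e n 1 ≃* BkMonoid e n k) :
    Nat.Coprime k e := by
  choose f hf using BkMonoid.exists_map_mk_of φ
  rw [← ZMod.isUnit_iff_coprime]
  refine isUnit_of_injective_of_mul_eq (n := n) he (fun i => f (Sum.inl i)) ?_ fun i j => ?_
  · intro i j (hij : f (Sum.inl i) = f (Sum.inl j))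
    refine Sum.inl_injective (mk_of_injective e n 1 (φ.injective ?_))
    exact (hf _).trans (hij ▸ (hf _).symm)
  · have hrel := congrArg φ (BkMonoid.mk_mul_mk_sub (n := n) (k := 1) i j)
    rw [Nat.cast_one, map_mul, map_mul, hf, hf, hf, hf] at hrel
    exact (Con.eq _).1 hrel

/-- `B^{⊕k}(e,e,n)` is isomorphic to the Corran–Picantin
monoid `B^{⊕}(e,e,n) = B^{⊕1}(e,e,n)` if and only if `gcd(k,e) = 1`;
moreover, when `gcd(k,e) = 1`, an isomorphism is given by
`s̃_j ↦ s̃_j`, `t̃_i ↦ t̃_{ik}`. -/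
theorem statement14 (e n k : ℕ) (hn : 2 ≤ n) (hk1 : 1 ≤ k) (hk : k ≤ e - 1) :
    (Nonempty (BkMonoid e n k ≃* BkMonoid e n 1) ↔ Nat.Coprime k e) ∧
    (Nat.Coprime k e →
      ∃ φ : BkMonoid e n 1 ≃* BkMonoid e n k,
        (∀ p : Fin (n - 2),
          φ ((conGen (BkRel e n 1)).mk' (FreeMonoid.of (Sum.inr p))) =
            (conGen (BkRel e n k)).mk' (FreeMonoid.of (Sum.inr p))) ∧
        (∀ i : ZMod e,
          φ ((conGen (BkRel e n 1)).mk' (FreeMonoid.of (Sum.inl i))) =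
            (conGen (BkRel e n k)).mk' (FreeMonoid.of (Sum.inl (i * (k : ZMod e)))))) := by
  have iso (h : Nat.Coprime k e) : ∃ φ : BkMonoid e n 1 ≃* BkMonoid e n k,
      (∀ p : Fin (n - 2),
        φ ((conGen (BkRel e n 1)).mk' (FreeMonoid.of (Sum.inr p))) =
          (conGen (BkRel e n k)).mk' (FreeMonoid.of (Sum.inr p))) ∧
      (∀ i : ZMod e,
        φ ((conGen (BkRel e n 1)).mk' (FreeMonoid.of (Sum.inl i))) =
          (conGen (BkRel e n k)).mk' (FreeMonoid.of (Sum.inl (i * (k : ZMod e))))) := by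
    obtain ⟨v, hv⟩ := ((ZMod.isUnit_iff_coprime k e).2 h).exists_right_inv
    exact ⟨BkMonoid.twistEquiv k v hv (by simp), fun _ => rfl, fun _ => rfl⟩
  refine ⟨⟨fun ⟨ψ⟩ => ?_, fun h => ?_⟩, iso⟩
  · obtain he | he : 3 ≤ e ∨ k = 1 := by omega
    · exact coprime_of_mulEquiv he ψ.symm
    · exact he ▸ Nat.coprime_one_left e
  · obtain ⟨φ, -⟩ := iso h
    exact ⟨φ.symm⟩
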